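/- arXiv:1604.08166 — 2 statements merged into one kernel-verified Lean document; each statement's English description precedes it below -/
import Mathlib

section
/- Let ω ∈ E^ℕ, and for N ∈ ℕ set P_N = Σ_{n=1}^N δ_{ω_n} and P̂_N = N^{-1} P_N. Then for all C > 1 and ε > 0, there exist a rational λ > 1 and a continuous exponentially λ-periodic cycle r : (0,∞) → P with r_b(a) > 0 for all b > 0 and a ∈ E, such that for all B ∈ [1,λ]: liminf_{k→∞} sup_{M∈[C^{-1}λ^k B, Cλ^k B]} ‖R̂_M − P̂_M‖ ≤ ε, where R̂_M = M^{-1}∫_0^M r_b db and ‖·‖ is the total variation norm ‖p‖ = Σ_{a∈E}|p(a)| on signed measures on E (with P̂_M interpreted via M ↦ P̂_⌈M⌉ or any fixed extension; in the paper P̂_M is the normalized empirical measure at integer times). -/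
open MeasureTheory Filter Set
open scoped Topology ENNReal Classical

/-- A nondecreasing `1`-Lipschitz function vanishing at `0`, such as the occupation time of a
state up to time `x`. -/
def IsOccupation (F : ℝ → ℝ) : Prop :=
  F 0 = 0 ∧ ∀ x y, x ≤ y → 0 ≤ F y - F x ∧ F y - F x ≤ y - x

namespace IsOccupation

variable {F : ℝ → ℝ}

theorem continuous (hF : IsOccupation F) : Continuous F := by
  have h : LipschitzWith 1 F := by
    refine LipschitzWith.of_le_add fun x y => ?_
    rw [Real.dist_eq]
    rcases le_total x y with h | h
    · linarith [(hF.2 x y h).1, abs_nonneg (x - y)]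
    · linarith [(hF.2 y x h).2, le_abs_self (x - y)]
  exact h.continuous

theorem ratio_mem_Icc (hF : IsOccupation F) {x : ℝ} (hx : 0 < x) : F x / x ∈ Icc (0 : ℝ) 1 := by
  have h := hF.2 0 x hx.le
  rw [hF.1] at h
  exact ⟨div_nonneg (by linarith) hx.le, (div_le_one hx).2 (by linarith)⟩

theorem abs_ratio_sub_ratio_le (hF : IsOccupation F) {x y τ : ℝ} (hx : 0 < x) (hxy : x ≤ y)
    (hy : y ≤ (1 + τ) * x) : |F y / y - F x / x| ≤ τ := by
  have hy0 : 0 < y := hx.trans_le hxy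
  have h1 := hF.2 x y hxy
  have h2 := hF.2 0 x hx.le
  rw [hF.1] at h2
  have hτ : 0 ≤ τ := by nlinarith
  have hτy : y - x ≤ τ * y := by nlinarith
  have hq : F x / x ∈ Icc (0 : ℝ) 1 := hF.ratio_mem_Icc hx
  have key : F y / y - F x / x = ((F y - F x) - F x / x * (y - x)) / y := by
    field_simp
    ring
  rw [key, abs_div, abs_of_pos hy0, div_le_iff₀ hy0, abs_le]
  constructor <;> nlinarith [hq.1, hq.2]

theorem continuousOn_ratio (hF : IsOccupation F) : ContinuousOn (fun u => F u / u) (Ioi 0) :=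
  hF.continuous.continuousOn.div continuousOn_id fun _ hx => ne_of_gt hx

theorem intervalIntegrable_ratio (hF : IsOccupation F) {x y : ℝ} (hx : 0 ≤ x) (hy : 0 ≤ y) :
    IntervalIntegrable (fun u => F u / u) volume x y := by
  rw [intervalIntegrable_iff]
  refine Measure.integrableOn_of_bounded (M := 1) (by simp) ?_ ?_
  · exact (hF.continuous.measurable.div measurable_id).aestronglyMeasurable
  · refine (ae_restrict_iff' measurableSet_uIoc).2 (Eventually.of_forall fun u hu => ?_)
    have hu0 : 0 < u := (le_min hx hy).trans_lt hu.1
    have h := hF.ratio_mem_Icc hu0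
    rw [Real.norm_eq_abs, abs_of_nonneg h.1]
    exact h.2

/-- Averaging the increments of `F` over a geometric window produces a density whose running
mean is close to that of `F`. -/
theorem abs_mean_smoothed_sub_ratio_le (hF : IsOccupation F) {τ M : ℝ} (hτ : 0 < τ) (hM : 0 < M) :
    |M⁻¹ * (∫ b in (0 : ℝ)..M,
      ((1 + τ) * (F ((1 + τ) * b) / ((1 + τ) * b)) - F b / b) / τ) - F M / M| ≤ τ := by
  have hρ : 0 < 1 + τ := by linarith
  have hMρ : 0 ≤ (1 + τ) * M := by positivity
  have hi0 := hF.intervalIntegrable_ratio le_rfl hM.le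
  have hi1 := hF.intervalIntegrable_ratio le_rfl hMρ
  have hi2 := hF.intervalIntegrable_ratio hM.le hMρ
  have hi3 : IntervalIntegrable (fun b => F ((1 + τ) * b) / ((1 + τ) * b)) volume 0 M := by
    have := hi1.comp_mul_left (c := 1 + τ)
    simpa [hρ.ne'] using this
  have e1 : (∫ b in (0 : ℝ)..M,
      ((1 + τ) * (F ((1 + τ) * b) / ((1 + τ) * b)) - F b / b) / τ)
      = (∫ u in M..(1 + τ) * M, F u / u) / τ := by
    rw [intervalIntegral.integral_div,
      intervalIntegral.integral_sub (hi3.const_mul _) hi0,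
      intervalIntegral.integral_const_mul,
      intervalIntegral.mul_integral_comp_mul_left (f := fun u => F u / u) (c := 1 + τ)]
    rw [mul_zero, ← intervalIntegral.integral_add_adjacent_intervals hi0 hi2]
    ring
  have e2 : (∫ u in M..(1 + τ) * M, F u / u) - τ * M * (F M / M)
      = ∫ u in M..(1 + τ) * M, (F u / u - F M / M) := by
    rw [intervalIntegral.integral_sub hi2 (by simp), intervalIntegral.integral_const, smul_eq_mul]
    ring
  have hle : M ≤ (1 + τ) * M := by nlinarith
  have e3 : ‖∫ u in M..(1 + τ) * M, (F u / u - F M / M)‖ ≤ τ * |(1 + τ) * M - M| := by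
    refine intervalIntegral.norm_integral_le_of_norm_le_const fun u hu => ?_
    rw [uIoc_of_le hle] at hu
    exact hF.abs_ratio_sub_ratio_le hM hu.1.le hu.2
  rw [← e2, Real.norm_eq_abs, abs_of_nonneg (by linarith : 0 ≤ (1 + τ) * M - M)] at e3
  rw [e1]
  have e4 : M⁻¹ * ((∫ u in M..(1 + τ) * M, F u / u) / τ) - F M / M
      = ((∫ u in M..(1 + τ) * M, F u / u) - τ * M * (F M / M)) / (τ * M) := by
    field_simp
  rw [e4, abs_div, abs_of_pos (by positivity : 0 < τ * M), div_le_iff₀ (by positivity)]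
  linarith

end IsOccupation

/-- Bounded families over a finite index set can be coloured with finitely many colours so that
families of the same colour are uniformly close. -/
theorem exists_finite_coloring (ι : Type) [Finite ι] {δ : ℝ} (hδ : 0 < δ) :
    ∃ (κ : Type) (_ : Fintype κ) (q : (ι → ℝ) → κ), ∀ u v : ι → ℝ,
      (∀ i, u i ∈ Icc (0 : ℝ) 1) → (∀ i, v i ∈ Icc (0 : ℝ) 1) → q u = q v →
      ∀ i, |u i - v i| ≤ δ := by
  obtain ⟨K, hK⟩ := exists_nat_gt δ⁻¹
  have hK0 : (0 : ℝ) < K := (inv_pos.2 hδ).trans hK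
  have := Fintype.ofFinite ι
  refine ⟨ι → Fin (K + 1), inferInstance, fun u i => Fin.ofNat (K + 1) ⌊u i * K⌋₊, ?_⟩
  intro u v hu hv huv i
  have hlt : ∀ x : ℝ, x ∈ Icc (0 : ℝ) 1 → ⌊x * K⌋₊ < K + 1 := fun x hx => by
    rw [Nat.lt_succ_iff]
    exact Nat.floor_le_of_le (by nlinarith [hx.2])
  have h := congrArg Fin.val (congrFun huv i)
  simp only [Fin.val_ofNat] at h
  rw [Nat.mod_eq_of_lt (hlt _ (hu i)), Nat.mod_eq_of_lt (hlt _ (hv i))] at h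
  have h1 := Nat.floor_le (mul_nonneg (hu i).1 hK0.le)
  have h2 := Nat.lt_floor_add_one (u i * K)
  have h3 := Nat.floor_le (mul_nonneg (hv i).1 hK0.le)
  have h4 := Nat.lt_floor_add_one (v i * K)
  rw [h] at h1 h2
  have h5 : 1 ≤ δ * K := by
    rw [inv_lt_iff_one_lt_mul₀ hδ] at hK
    linarith
  rw [abs_le]
  constructor <;> refine le_of_mul_le_mul_right ?_ hK0 <;> linarith

/-- A bounded sequence has a window along which it is nearly `n`-periodic, with `n` arbitrarily
large, and which recurs nearly unchanged infinitely often in one residue class modulo `n`. -/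
theorem exists_recurrent_window {E : Type} [Finite E] (u : ℕ → E → ℝ)
    (hu : ∀ n a, u n a ∈ Icc (0 : ℝ) 1) {δ : ℝ} (hδ : 0 < δ) (W w : ℕ) (hW : 0 < W) :
    ∃ n m₀ : ℕ, W ≤ n ∧ (∀ j ≤ w, ∀ a, |u (m₀ + n + j) a - u (m₀ + j) a| ≤ δ) ∧
      ∃ᶠ m in atTop, m % n = m₀ % n ∧
        ∀ j ≤ n + w, ∀ a, |u (m + j) a - u (m₀ + j) a| ≤ δ := by
  obtain ⟨κ, _, q, hq⟩ := exists_finite_coloring (Fin (w + 1) × E) hδ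
  let c : ℕ → κ := fun m => q fun p => u (m + p.1) p.2
  have h1 : ∃ᶠ m in (atTop : Filter ℕ), ∃ d : Fin (Fintype.card κ + 1),
      0 < d.val ∧ c (m + W * d) = c m := by
    refine frequently_atTop.2 fun N => ?_
    obtain ⟨i, j, hij, hc⟩ := Fintype.exists_ne_map_eq_of_card_lt
      (fun i : Fin (Fintype.card κ + 1) => c (N + W * i)) (by simp)
    wlog hlt : i < j generalizing i j
    · exact this j i hij.symm hc.symm (lt_of_le_of_ne (not_lt.1 hlt) hij.symm)
    have hlt' : i.val < j.val := hlt
    refine ⟨N + W * i, by simp, ⟨j - i, by omega⟩, by simpa using hlt', ?_⟩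
    rw [add_assoc, ← mul_add]
    simpa [Nat.add_sub_cancel' hlt'.le] using hc.symm
  obtain ⟨d, hd⟩ := frequently_exists.1 h1
  have hd0 : 0 < d.val := hd.exists.choose_spec.1
  set n := W * d.val with hn
  have hn0 : 0 < n := Nat.mul_pos hW hd0
  obtain ⟨κ', _, q', hq'⟩ := exists_finite_coloring (Fin (n + w + 1) × E) hδ
  let c' : ℕ → κ' := fun m => q' fun p => u (m + p.1) p.2
  have h2 : ∃ᶠ m in (atTop : Filter ℕ), ∃ k : Fin n × κ',
      c (m + n) = c m ∧ m % n = k.1 ∧ c' m = k.2 :=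
    hd.mono fun m hm => ⟨(⟨m % n, Nat.mod_lt _ hn0⟩, c' m), hm.2, rfl, rfl⟩
  obtain ⟨k, hk⟩ := frequently_exists.1 h2
  obtain ⟨m₀, hm₀, hmod, hcol⟩ := hk.exists
  refine ⟨n, m₀, Nat.le_mul_of_pos_right _ hd0, ?_, ?_⟩
  · intro j hj a
    exact hq _ _ (fun _ => hu _ _) (fun _ => hu _ _) hm₀ (⟨j, by omega⟩, a)
  · refine hk.mono fun m hm => ⟨hm.2.1.trans hmod.symm, fun j hj a => ?_⟩
    exact hq' _ _ (fun _ => hu _ _) (fun _ => hu _ _) (hm.2.2.trans hcol.symm)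
      (⟨j, by omega⟩, a)

section Occupation

variable {E : Type}

/-- The time the path `ξ` spends in the state `a` during `[0, x]`. -/
noncomputable def occupation (ξ : ℝ → E) (a : E) (x : ℝ) : ℝ :=
  ∫ t in (0 : ℝ)..x, if ξ t = a then (1 : ℝ) else 0

theorem intervalIntegrable_indicator {ξ : ℝ → E} {a : E} (hξ : MeasurableSet {t | ξ t = a})
    (x y : ℝ) : IntervalIntegrable (fun t => if ξ t = a then (1 : ℝ) else 0) volume x y := by
  rw [intervalIntegrable_iff]
  refine Measure.integrableOn_of_bounded (M := 1) (by simp) ?_ ?_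
  · exact (Measurable.ite hξ measurable_const measurable_const).aestronglyMeasurable
  · refine Eventually.of_forall fun u => ?_
    split_ifs <;> simp

theorem occupation_sub {ξ : ℝ → E} {a : E} (hξ : MeasurableSet {t | ξ t = a}) (x y : ℝ) :
    occupation ξ a y - occupation ξ a x = ∫ t in x..y, if ξ t = a then (1 : ℝ) else 0 :=
  intervalIntegral.integral_interval_sub_left (intervalIntegrable_indicator hξ _ _)
    (intervalIntegrable_indicator hξ _ _)

theorem isOccupation_occupation {ξ : ℝ → E} {a : E} (hξ : MeasurableSet {t | ξ t = a}) :
    IsOccupation (occupation ξ a) := by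
  refine ⟨by simp [occupation], fun x y hxy => ?_⟩
  rw [occupation_sub hξ]
  constructor
  · refine intervalIntegral.integral_nonneg hxy fun t _ => ?_
    split_ifs <;> simp
  · have h := intervalIntegral.integral_mono_on hxy (intervalIntegrable_indicator hξ x y)
      (intervalIntegrable_const (c := (1 : ℝ))) (fun t _ => by split_ifs <;> simp)
    simpa using h

theorem sum_occupation [Fintype E] {ξ : ℝ → E} (hξ : ∀ a, MeasurableSet {t | ξ t = a}) (x : ℝ) :
    ∑ a, occupation ξ a x = x := by
  unfold occupation
  rw [← intervalIntegral.integral_finsetSum fun a _ => intervalIntegrable_indicator (hξ a) _ _]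
  simp

theorem occupation_mul {ξ : ℝ → E} (a : E) {c : ℝ} (hξ : ∀ t ≥ 0, ξ (c * t) = ξ t)
    {x : ℝ} (hx : 0 ≤ x) : occupation ξ a (c * x) = c * occupation ξ a x := by
  unfold occupation
  have h := intervalIntegral.mul_integral_comp_mul_left (a := 0) (b := x)
    (f := fun t => if ξ t = a then (1 : ℝ) else 0) (c := c)
  rw [mul_zero] at h
  rw [← h]
  congr 1
  refine intervalIntegral.integral_congr fun t ht => ?_
  rw [uIcc_of_le hx] at ht
  simp only [hξ t ht.1]

theorem measurableSet_floor_path (ω : ℕ → E) (a : E) :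
    MeasurableSet {t : ℝ | ω ⌊t⌋₊ = a} :=
  Nat.measurable_floor (MeasurableSet.of_discrete (s := {n | ω n = a}))

theorem occupation_floor_natCast (ω : ℕ → E) (a : E) (N : ℕ) :
    occupation (fun t => ω ⌊t⌋₊) a N
      = ∑ n ∈ Finset.range N, if ω n = a then (1 : ℝ) else 0 := by
  induction N with
  | zero => simp [occupation]
  | succ N ih =>
    rw [Finset.sum_range_succ, ← ih, ← sub_eq_iff_eq_add',
      occupation_sub (measurableSet_floor_path ω a)]
    rw [intervalIntegral.integral_congr_Ioo_of_le
      (g := fun _ => if ω N = a then (1 : ℝ) else 0) (by simp)]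
    · simp
    · intro t ht
      have h : ⌊t⌋₊ = N := by
        rw [Nat.floor_eq_iff ((Nat.cast_nonneg N).trans ht.1.le)]
        exact ⟨ht.1.le, by exact_mod_cast ht.2⟩
      simp only [h]

/-- The `c`-homogeneous path agreeing with `ω ⌊t⌋₊` on `[x₀, c x₀)`. -/
noncomputable def periodicPath (ω : ℕ → E) (c x₀ t : ℝ) : E :=
  ω ⌊t * c ^ (-⌊Real.log (t / x₀) / Real.log c⌋)⌋₊

theorem measurableSet_periodicPath (ω : ℕ → E) (c x₀ : ℝ) (a : E) :
    MeasurableSet {t : ℝ | periodicPath ω c x₀ t = a} := by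
  have h1 : Measurable fun t : ℝ => ⌊Real.log (t / x₀) / Real.log c⌋ :=
    Int.measurable_floor.comp
      ((Real.measurable_log.comp (measurable_id.div_const x₀)).div_const _)
  have h2 : Measurable fun k : ℤ => c ^ (-k) := measurable_from_top
  exact (measurable_id.mul (h2.comp h1)) (measurableSet_floor_path ω a)

theorem periodicPath_mul (ω : ℕ → E) {c x₀ : ℝ} (hc : 1 < c) (hx₀ : 0 < x₀) (t : ℝ) (ht : 0 ≤ t) :
    periodicPath ω c x₀ (c * t) = periodicPath ω c x₀ t := by
  rcases ht.eq_or_lt with rfl | ht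
  · simp
  have hc0 : 0 < c := by linarith
  have hl : Real.log c ≠ 0 := (Real.log_pos hc).ne'
  unfold periodicPath
  rw [mul_div_assoc, Real.log_mul hc0.ne' (by positivity), add_div, div_self hl, add_comm,
    Int.floor_add_one, neg_add, zpow_add₀ hc0.ne', zpow_neg_one]
  congr 2
  field_simp

theorem periodicPath_eq (ω : ℕ → E) {c x₀ t : ℝ} (hc : 1 < c) (hx₀ : 0 < x₀) (ht : x₀ < t)
    (ht' : t < c * x₀) : periodicPath ω c x₀ t = ω ⌊t⌋₊ := by
  have hl : 0 < Real.log c := Real.log_pos hc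
  have h : ⌊Real.log (t / x₀) / Real.log c⌋ = 0 := by
    rw [Int.floor_eq_zero_iff]
    constructor
    · exact div_nonneg (Real.log_nonneg ((one_le_div hx₀).2 ht.le)) hl.le
    · rw [div_lt_one hl]
      exact Real.log_lt_log (div_pos (hx₀.trans ht) hx₀) ((div_lt_iff₀ hx₀).2 ht')
  simp [periodicPath, h]

/-- If the empirical frequencies of `ω` at `x₀` and `c x₀` are close, then on `[x₀, c x₀]` the
periodized path has nearly the same frequencies as `ω`. -/
theorem abs_ratio_periodicPath_sub_le (ω : ℕ → E) (a : E) {c x₀ x δ : ℝ} (hc : 2 ≤ c)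
    (hx₀ : 0 < x₀) (hx : x₀ ≤ x) (hx' : x ≤ c * x₀)
    (hδ : |occupation (fun t => ω ⌊t⌋₊) a (c * x₀) / (c * x₀)
      - occupation (fun t => ω ⌊t⌋₊) a x₀ / x₀| ≤ δ) :
    |occupation (periodicPath ω c x₀) a x / x - occupation (fun t => ω ⌊t⌋₊) a x / x|
      ≤ 2 * δ := by
  have hS := measurableSet_floor_path ω a
  have hP := measurableSet_periodicPath ω c x₀ a
  have hc1 : 1 < c := by linarith
  have inc : ∀ y, x₀ ≤ y → y ≤ c * x₀ →
      occupation (periodicPath ω c x₀) a y - occupation (periodicPath ω c x₀) a x₀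
      = occupation (fun t => ω ⌊t⌋₊) a y - occupation (fun t => ω ⌊t⌋₊) a x₀ := by
    intro y h1 h2
    rw [occupation_sub hS, occupation_sub hP]
    refine intervalIntegral.integral_congr_Ioo_of_le h1 fun t ht => ?_
    simp only [periodicPath_eq ω hc1 hx₀ ht.1 (ht.2.trans_le h2)]
  have h1 := inc x hx hx'
  have h2 := inc (c * x₀) (by nlinarith) le_rfl
  rw [occupation_mul a (fun t ht => periodicPath_mul ω hc1 hx₀ t ht) hx₀.le] at h2
  set F := occupation (periodicPath ω c x₀) a
  set S := occupation (fun t => ω ⌊t⌋₊) a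
  have hx0 : 0 < x := hx₀.trans_le hx
  have hcx : 0 < c * x₀ := by nlinarith
  rw [abs_le] at hδ
  have e : S (c * x₀) / (c * x₀) - S x₀ / x₀ = (c - 1) * (F x₀ - S x₀) / (c * x₀) := by
    field_simp
    linear_combination -h2
  rw [e, le_div_iff₀ hcx, div_le_iff₀ hcx] at hδ
  have hδ0 : 0 ≤ δ := by nlinarith
  have e2 : F x / x - S x / x = (F x₀ - S x₀) / x := by
    rw [← sub_div]; congr 1; linarith
  have hc' : 0 < c - 1 := by linarith
  have hb : c * x₀ * δ ≤ (c - 1) * (2 * δ * x₀) := by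
    nlinarith [mul_nonneg (mul_nonneg hδ0 hx₀.le) (sub_nonneg.2 hc)]
  have hb2 : 2 * δ * x₀ ≤ 2 * δ * x := by gcongr
  rw [e2, abs_div, abs_of_pos hx0, div_le_iff₀ hx0, abs_le]
  constructor
  · have : -(2 * δ * x₀) ≤ F x₀ - S x₀ := le_of_mul_le_mul_left (by linarith) hc'
    linarith
  · have : F x₀ - S x₀ ≤ 2 * δ * x₀ := le_of_mul_le_mul_left (by linarith) hc'
    linarith

theorem abs_ratio_sub_empirical_le (ω : ℕ → E) (a : E) {τ M : ℝ} (hM : 0 < M) (hτM : 1 ≤ τ * M) :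
    |occupation (fun t => ω ⌊t⌋₊) a M / M - (⌈M⌉₊ : ℝ)⁻¹ * ∑ n ∈ Finset.range ⌈M⌉₊,
      (if ω n = a then (1 : ℝ) else 0)| ≤ τ := by
  have h := (isOccupation_occupation (measurableSet_floor_path ω a)).abs_ratio_sub_ratio_le
    (τ := τ) hM (Nat.le_ceil M) (by linarith [Nat.ceil_lt_add_one hM.le])
  rwa [occupation_floor_natCast, div_eq_inv_mul, abs_sub_comm] at h

theorem ratio_periodicPath_pow_mul (ω : ℕ → E) (a : E) {c x₀ x : ℝ} (hc : 1 < c) (hx₀ : 0 < x₀)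
    (hx : 0 < x) (k : ℕ) :
    occupation (periodicPath ω c x₀) a (c ^ k * x) / (c ^ k * x)
      = occupation (periodicPath ω c x₀) a x / x := by
  have hc0 : 0 < c := by linarith
  induction k with
  | zero => simp
  | succ k ih =>
    rw [← ih, pow_succ', mul_assoc,
      occupation_mul a (fun t ht => periodicPath_mul ω hc hx₀ t ht) (by positivity),
      mul_div_mul_left _ _ hc0.ne']

/-- Along a nearly periodic recurrent window, the frequencies of `ω` follow those of the
periodized path. -/
theorem abs_ratio_periodicPath_sub_le_of_window (ω : ℕ → E) (a : E) {ρ δ : ℝ} {n w m₀ m j : ℕ}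
    (hρ : 1 < ρ) (hρn : 2 ≤ ρ ^ n) (hwn : w ≤ n) (hmm : m₀ ≤ m) (hmod : m % n = m₀ % n)
    (hj : j ≤ n + w)
    (hper : ∀ j ≤ w, |occupation (fun t => ω ⌊t⌋₊) a (ρ ^ (m₀ + n + j)) / ρ ^ (m₀ + n + j)
      - occupation (fun t => ω ⌊t⌋₊) a (ρ ^ (m₀ + j)) / ρ ^ (m₀ + j)| ≤ δ)
    (hrec : |occupation (fun t => ω ⌊t⌋₊) a (ρ ^ (m + j)) / ρ ^ (m + j)
      - occupation (fun t => ω ⌊t⌋₊) a (ρ ^ (m₀ + j)) / ρ ^ (m₀ + j)| ≤ δ) :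
    |occupation (periodicPath ω (ρ ^ n) (ρ ^ m₀)) a (ρ ^ (m + j)) / ρ ^ (m + j)
      - occupation (fun t => ω ⌊t⌋₊) a (ρ ^ (m + j)) / ρ ^ (m + j)| ≤ 4 * δ := by
  have hρ0 : 0 < ρ := by linarith
  have hδ : 0 ≤ δ := (abs_nonneg _).trans hrec
  obtain ⟨q, hq⟩ : ∃ q, m = n * q + m₀ := by
    obtain ⟨q, hq⟩ := (Nat.modEq_iff_dvd' hmm).1 hmod.symm
    exact ⟨q, by omega⟩
  have hstart := hper 0 (Nat.zero_le _)
  rw [add_zero, add_zero, add_comm m₀ n, pow_add] at hstart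
  have base : ∀ i ≤ n, |occupation (periodicPath ω (ρ ^ n) (ρ ^ m₀)) a (ρ ^ (m₀ + i))
      / ρ ^ (m₀ + i) - occupation (fun t => ω ⌊t⌋₊) a (ρ ^ (m₀ + i)) / ρ ^ (m₀ + i)|
      ≤ 2 * δ := fun i hi => by
    refine abs_ratio_periodicPath_sub_le ω a hρn (by positivity)
      (pow_le_pow_right₀ hρ.le (by omega)) ?_ hstart
    rw [← pow_add]
    exact pow_le_pow_right₀ hρ.le (by omega)
  have shift : ∀ k i : ℕ, occupation (periodicPath ω (ρ ^ n) (ρ ^ m₀)) a (ρ ^ (n * k + i))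
      / ρ ^ (n * k + i) = occupation (periodicPath ω (ρ ^ n) (ρ ^ m₀)) a (ρ ^ i) / ρ ^ i :=
    fun k i => by
      rw [pow_add, pow_mul]
      exact ratio_periodicPath_pow_mul ω a (by linarith) (by positivity) (by positivity) k
  rcases le_or_gt j n with hjn | hjn
  · have h1 := base j hjn
    have h2 := shift q (m₀ + j)
    rw [show n * q + (m₀ + j) = m + j by omega] at h2
    rw [h2]
    rw [abs_le] at *
    constructor <;> linarith
  · have h1 := base (j - n) (by omega)
    have h2 := shift (q + 1) (m₀ + (j - n))
    have h3 := hper (j - n) (by omega)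
    rw [show n * (q + 1) + (m₀ + (j - n)) = m + j by rw [mul_add]; omega] at h2
    rw [show m₀ + n + (j - n) = m₀ + j by omega] at h3
    rw [h2]
    rw [abs_le] at *
    constructor <;> linarith

/-- The smoothed, strictly positive version of the occupation densities of `ξ`. -/
noncomputable def smoothedCycle [Fintype E] (ξ : ℝ → E) (τ b : ℝ) (a : E) : ℝ :=
  (1 - τ) * (((1 + τ) * (occupation ξ a ((1 + τ) * b) / ((1 + τ) * b))
    - occupation ξ a b / b) / τ) + τ * (Fintype.card E : ℝ)⁻¹

section SmoothedCycle

variable [Fintype E] {ξ : ℝ → E} {τ : ℝ}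

theorem smoothedCycle_pos [Nonempty E] (hξ : ∀ a, MeasurableSet {t | ξ t = a}) (hτ : 0 < τ)
    (hτ1 : τ < 1) {b : ℝ} (hb : 0 < b) (a : E) : 0 < smoothedCycle ξ τ b a := by
  have hcard : (0 : ℝ) < Fintype.card E := by exact_mod_cast Fintype.card_pos
  have hρ : 0 < 1 + τ := by linarith
  have h := ((isOccupation_occupation (hξ a)).2 b ((1 + τ) * b) (by nlinarith)).1
  have e : (1 + τ) * (occupation ξ a ((1 + τ) * b) / ((1 + τ) * b)) - occupation ξ a b / b
      = (occupation ξ a ((1 + τ) * b) - occupation ξ a b) / b := by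
    field_simp
  have h1 : 0 < 1 - τ := by linarith
  unfold smoothedCycle
  rw [e]
  positivity

theorem sum_smoothedCycle [Nonempty E] (hξ : ∀ a, MeasurableSet {t | ξ t = a}) (hτ : 0 < τ)
    {b : ℝ} (hb : 0 < b) : ∑ a, smoothedCycle ξ τ b a = 1 := by
  have hcard : (Fintype.card E : ℝ) ≠ 0 := by exact_mod_cast Fintype.card_ne_zero
  have hρ : 0 < 1 + τ := by linarith
  unfold smoothedCycle
  rw [Finset.sum_add_distrib, ← Finset.mul_sum, ← Finset.sum_div, Finset.sum_sub_distrib,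
    ← Finset.mul_sum, ← Finset.sum_div, ← Finset.sum_div, sum_occupation hξ, sum_occupation hξ,
    Finset.sum_const, Finset.card_univ, nsmul_eq_mul, div_self (by positivity), div_self hb.ne']
  field_simp
  ring

theorem continuousOn_smoothedCycle (hξ : ∀ a, MeasurableSet {t | ξ t = a}) (hτ : 0 < τ) :
    ContinuousOn (smoothedCycle ξ τ) (Ioi 0) := by
  refine continuousOn_pi.2 fun a => ?_
  have h := (isOccupation_occupation (hξ a)).continuousOn_ratio
  have h' : ContinuousOn (fun b => occupation ξ a ((1 + τ) * b) / ((1 + τ) * b)) (Ioi 0) :=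
    h.comp (f := fun b => (1 + τ) * b) (by fun_prop) fun b hb =>
      mul_pos (by linarith) (mem_Ioi.1 hb)
  unfold smoothedCycle
  fun_prop

theorem smoothedCycle_mul {c b : ℝ} (hc : 0 < c) (hξ : ∀ t ≥ 0, ξ (c * t) = ξ t) (hτ : 0 < τ)
    (hb : 0 < b) : smoothedCycle ξ τ (c * b) = smoothedCycle ξ τ b := by
  funext a
  unfold smoothedCycle
  rw [mul_left_comm, occupation_mul a hξ hb.le, occupation_mul a hξ (by positivity),
    mul_div_mul_left _ _ hc.ne', mul_div_mul_left _ _ hc.ne']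

theorem abs_mean_smoothedCycle_sub_le [Nonempty E] (hξ : ∀ a, MeasurableSet {t | ξ t = a})
    (hτ : 0 < τ) (hτ1 : τ < 1) {M : ℝ} (hM : 0 < M) (a : E) :
    |M⁻¹ * (∫ b in Ioc (0 : ℝ) M, smoothedCycle ξ τ b a) - occupation ξ a M / M| ≤ 2 * τ := by
  have hcard : (1 : ℝ) ≤ Fintype.card E := by exact_mod_cast Fintype.card_pos
  have hF := isOccupation_occupation (hξ a)
  have hρ : 0 < 1 + τ := by linarith
  have hi := hF.intervalIntegrable_ratio le_rfl hM.le
  have hi' : IntervalIntegrable (fun b => occupation ξ a ((1 + τ) * b) / ((1 + τ) * b))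
      volume 0 M := by
    have := (hF.intervalIntegrable_ratio le_rfl
      (by positivity : 0 ≤ (1 + τ) * M)).comp_mul_left (c := 1 + τ)
    simpa [hρ.ne'] using this
  have h := hF.abs_mean_smoothed_sub_ratio_le hτ hM
  rw [← intervalIntegral.integral_of_le hM.le]
  unfold smoothedCycle
  rw [intervalIntegral.integral_add ((((hi'.const_mul _).sub hi).div_const _).const_mul _)
    (by simp), intervalIntegral.integral_const_mul, intervalIntegral.integral_const, smul_eq_mul,
    sub_zero]
  set X := ∫ b in (0 : ℝ)..M, ((1 + τ) * (occupation ξ a ((1 + τ) * b) / ((1 + τ) * b))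
    - occupation ξ a b / b) / τ
  have hq := hF.ratio_mem_Icc hM
  have hc0 : 0 < (Fintype.card E : ℝ)⁻¹ := by positivity
  have hc1 : (Fintype.card E : ℝ)⁻¹ ≤ 1 := inv_le_one_of_one_le₀ hcard
  have e : M⁻¹ * ((1 - τ) * X + M * (τ * (Fintype.card E : ℝ)⁻¹)) - occupation ξ a M / M
      = (1 - τ) * (M⁻¹ * X - occupation ξ a M / M)
        + τ * ((Fintype.card E : ℝ)⁻¹ - occupation ξ a M / M) := by
    field_simp
    ring
  rw [e]
  rw [abs_le] at h ⊢
  constructor <;> nlinarith [hq.1, hq.2, h.1, h.2]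

end SmoothedCycle

end Occupation

/-- Claim from the proof of Theorem `theoremgood2`: for any `ω ∈ E^ℕ`, `C > 1` and
`ε > 0` there are a rational `λ > 1` and a continuous, everywhere positive,
exponentially `λ`-periodic cycle `r : (0,∞) → P` such that for all `B ∈ [1,λ]`,
`liminf_{k→∞} sup_{M ∈ [C⁻¹λᵏB, CλᵏB]} ‖R̂_M − P̂_M‖ ≤ ε`, where
`R̂_M = M⁻¹∫_0^M r_b db`, `P̂_N = N⁻¹ Σ_{n<N} δ_{ω_n}` is the normalized empirical
measure (extended to real `M` via `M ↦ P̂_⌈M⌉`), and `‖·‖` is the total variation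
norm `‖p‖ = Σ_a |p(a)|`. -/
theorem exists_cycle_tracking_empirical
    {E : Type} [Fintype E] [Nonempty E] (ω : ℕ → E)
    (C : ℝ) (hC : 1 < C) (ε : ℝ) (hε : 0 < ε) :
    ∃ lam : ℚ, 1 < lam ∧ ∃ r : ℝ → E → ℝ,
      (∀ b > 0, (∀ a, 0 < r b a) ∧ ∑ a, r b a = 1) ∧
      ContinuousOn r (Set.Ioi 0) ∧
      (∀ b > 0, r ((lam : ℝ) * b) = r b) ∧
      ∀ B ∈ Set.Icc (1 : ℝ) (lam : ℝ),
        Filter.liminf (fun k : ℕ =>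
          sSup ((fun M : ℝ => ∑ a : E,
              |M⁻¹ * (∫ b in Set.Ioc (0:ℝ) M, r b a) -
                (⌈M⌉₊ : ℝ)⁻¹ * ∑ n ∈ Finset.range ⌈M⌉₊,
                  (if ω n = a then (1:ℝ) else 0)|) ''
            Set.Icc (C⁻¹ * (lam : ℝ) ^ k * B) (C * (lam : ℝ) ^ k * B)))
          Filter.atTop ≤ ε := by
  have hcard : (0 : ℝ) < Fintype.card E := by exact_mod_cast Fintype.card_pos
  obtain ⟨q, hq0, hq⟩ := exists_rat_btwn
    (lt_min (by positivity : 0 < ε / Fintype.card E / 9) one_half_pos)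
  obtain ⟨hqε, hq1⟩ := lt_min_iff.1 hq
  set τ : ℝ := (q : ℝ) with hτ
  have hτ1 : τ < 1 := by linarith
  have hρ : 1 < 1 + τ := by linarith
  obtain ⟨w, hw⟩ := pow_unbounded_of_one_lt (C ^ 2) hρ
  obtain ⟨W, hW⟩ := pow_unbounded_of_one_lt 2 hρ
  obtain ⟨n, m₀, hn, hper, hfreq⟩ := exists_recurrent_window
    (fun m a => occupation (fun t => ω ⌊t⌋₊) a ((1 + τ) ^ m) / (1 + τ) ^ m)
    (fun m a => (isOccupation_occupation (measurableSet_floor_path ω a)).ratio_mem_Icc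
      (by positivity)) hq0 (W + w + 1) w (by omega)
  have hn2 : 2 ≤ (1 + τ) ^ n := hW.le.trans (pow_le_pow_right₀ hρ.le (by omega))
  have hcast : (((1 + q) ^ n : ℚ) : ℝ) = (1 + τ) ^ n := by push_cast; rfl
  have hlam : 1 < (1 + τ) ^ n := by linarith
  have hmeas := measurableSet_periodicPath ω ((1 + τ) ^ n) ((1 + τ) ^ m₀)
  have hhom := periodicPath_mul ω hlam (by positivity : 0 < (1 + τ) ^ m₀)
  refine ⟨(1 + q) ^ n, ?_,
    smoothedCycle (periodicPath ω ((1 + τ) ^ n) ((1 + τ) ^ m₀)) τ, ?_, ?_, ?_, ?_⟩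
  · have : (1 : ℝ) < (((1 + q) ^ n : ℚ) : ℝ) := by rw [hcast]; exact hlam
    exact_mod_cast this
  · exact fun b hb => ⟨smoothedCycle_pos hmeas hq0 hτ1 hb, sum_smoothedCycle hmeas hq0 hb⟩
  · exact continuousOn_smoothedCycle hmeas hq0
  · intro b hb
    rw [hcast]
    exact smoothedCycle_mul (by linarith) hhom hq0 hb
  intro B hB
  rw [hcast]
  have hB0 : 0 < B := by linarith [hB.1]
  have hC0 : 0 < C := by linarith
  have hCB : 0 < C / B := by positivity
  refine liminf_le_of_frequently_le (frequently_atTop.2 fun k₀ => ?_)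
    (isBoundedUnder_of ⟨0, fun k => Real.sSup_nonneg ?_⟩)
  swap
  · rintro _ ⟨M, -, rfl⟩
    positivity
  have hpow := tendsto_pow_atTop_atTop_of_one_lt hρ
  obtain ⟨m, ⟨hmod, hrec⟩, hmm, hm1, hmk, hmx⟩ := (hfreq.and_eventually
    ((eventually_ge_atTop m₀).and <| ((hpow.const_mul_atTop hq0).eventually_ge_atTop 1).and <|
      ((hpow.atTop_mul_const hCB).eventually_ge_atTop (((1 + τ) ^ n) ^ k₀)).and <|
      (hpow.atTop_mul_const hCB).eventually_ge_atTop 1)).exists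
  obtain ⟨k, hk1, hk2⟩ := exists_nat_pow_near hmx hlam
  have hk0 : k₀ < k + 1 := (pow_lt_pow_iff_right₀ hlam).1 (hmk.trans_lt hk2)
  refine ⟨k + 1, hk0.le, Real.sSup_le ?_ hε.le⟩
  rintro _ ⟨M, ⟨hM1, hM2⟩, rfl⟩
  have hlow : (1 + τ) ^ m ≤ M := by
    refine le_trans ?_ hM1
    rw [← mul_div_assoc, div_lt_iff₀ hB0] at hk2
    rw [mul_assoc, inv_mul_eq_div, le_div_iff₀ hC0]
    exact hk2.le
  have hhigh : M ≤ (1 + τ) ^ (n + m + w) := by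
    rw [← mul_div_assoc, le_div_iff₀ hB0] at hk1
    calc M ≤ C * ((1 + τ) ^ n) ^ (k + 1) * B := hM2
      _ = (1 + τ) ^ n * C * (((1 + τ) ^ n) ^ k * B) := by ring
      _ ≤ (1 + τ) ^ n * C * ((1 + τ) ^ m * C) := by gcongr
      _ = (1 + τ) ^ (n + m) * C ^ 2 := by ring
      _ ≤ (1 + τ) ^ (n + m) * (1 + τ) ^ w := by gcongr
      _ = (1 + τ) ^ (n + m + w) := (pow_add _ _ _).symm
  have hM0 : 0 < M := lt_of_lt_of_le (by positivity) hlow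
  obtain ⟨t, ht1, ht2⟩ := exists_nat_pow_near ((one_le_pow₀ hρ.le).trans hlow) hρ
  have htm : m < t + 1 := (pow_lt_pow_iff_right₀ hρ).1 (hlow.trans_lt ht2)
  have htn : t ≤ n + m + w := (pow_le_pow_iff_right₀ hρ).1 (ht1.trans hhigh)
  obtain ⟨j, rfl⟩ : ∃ j, t = m + j := ⟨t - m, by omega⟩
  have hτM : 1 ≤ τ * M := hm1.trans (by gcongr)
  have hx0 : 0 < (1 + τ) ^ (m + j) := by positivity
  have hMx : M ≤ (1 + τ) * (1 + τ) ^ (m + j) := by rw [← pow_succ']; exact ht2.le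
  have hcoord : ∀ a, |M⁻¹ * (∫ b in Ioc (0 : ℝ) M,
      smoothedCycle (periodicPath ω ((1 + τ) ^ n) ((1 + τ) ^ m₀)) τ b a) -
        (⌈M⌉₊ : ℝ)⁻¹ * ∑ n ∈ Finset.range ⌈M⌉₊, (if ω n = a then (1 : ℝ) else 0)|
      ≤ ε / Fintype.card E := fun a => by
    have h1 := abs_mean_smoothedCycle_sub_le hmeas hq0 hτ1 hM0 a
    have h2 := (isOccupation_occupation (hmeas a)).abs_ratio_sub_ratio_le hx0 ht1 hMx
    have h3 := abs_ratio_periodicPath_sub_le_of_window ω a hρ hn2 (by omega : w ≤ n) hmm hmod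
      (by omega : j ≤ n + w) (fun j hj => hper j hj a) (hrec j (by omega) a)
    have h4 := (isOccupation_occupation (measurableSet_floor_path ω a)).abs_ratio_sub_ratio_le
      hx0 ht1 hMx
    have h5 := abs_ratio_sub_empirical_le ω a hM0 hτM
    rw [abs_le] at *
    constructor <;> linarith
  calc _ ≤ ∑ _a : E, ε / Fintype.card E := Finset.sum_le_sum fun a _ => hcoord a
    _ = ε := by
      rw [Finset.sum_const, Finset.card_univ, nsmul_eq_mul, mul_div_cancel₀ _ hcard.ne']
end

section
/- On the space of all diagonal IFSes with a fixed alphabet E (parameterized by the contraction ratios and translations of the defining similarities, with the natural topology), the functions Φ ↦ sup_{r∈R} δ(r) and Φ ↦ sup_{p∈P} δ(p) are continuous. -/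
open MeasureTheory Filter Set Metric
open scoped Classical Topology ENNReal NNReal

namespace SelfAffineSponge

/-- A diagonal IFS on `[0,1]^d`: for each coordinate `i ∈ D = Fin d` a finite alphabet
`A i` indexing affine maps `x ↦ slope i a * x + off i a` of `[0,1]`, together with a
set `E ⊆ ∏ i, A i` of allowed tuples of symbols. -/
structure DiagIFS (d : ℕ) (A : Fin d → Type) [∀ i, Fintype (A i)] where
  slope : ∀ i : Fin d, A i → ℝ
  off : ∀ i : Fin d, A i → ℝ
  E : Finset (∀ i, A i)

variable {d : ℕ} {A : Fin d → Type} [∀ i, Fintype (A i)]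

namespace DiagIFS

/-- the base similarity `φ_{i,a}` in coordinate `i` -/
def base (Φ : DiagIFS d A) (i : Fin d) (a : A i) (x : ℝ) : ℝ :=
  Φ.slope i a * x + Φ.off i a

/-- the data defines an honest diagonal IFS: `E` is nonempty and each base map is a
contracting similarity of `[0,1]` -/
def Valid (Φ : DiagIFS d A) : Prop :=
  Φ.E.Nonempty ∧ (∀ i a, Φ.slope i a ≠ 0) ∧ (∀ i a, |Φ.slope i a| < 1) ∧
    ∀ i a, ∀ x ∈ Set.Icc (0:ℝ) 1, Φ.base i a x ∈ Set.Icc (0:ℝ) 1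

/-- the alphabet `E` of the IFS, as a type -/
abbrev Symb (Φ : DiagIFS d A) : Type _ := {a : ∀ i, A i // a ∈ Φ.E}

instance (Φ : DiagIFS d A) : MeasurableSpace Φ.Symb := ⊤
instance (Φ : DiagIFS d A) : TopologicalSpace Φ.Symb := ⊥

/-- the affine contraction `φ_a` of `[0,1]^d` associated to a tuple of symbols -/
def affMap (Φ : DiagIFS d A) (a : ∀ i, A i) (x : Fin d → ℝ) : Fin d → ℝ :=
  fun i => Φ.base i (a i) (x i)

/-- the coding map `π(ω) = lim_n φ_{ω_0}∘⋯∘φ_{ω_{n-1}}(0)`, written in closed form -/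
noncomputable def coding (Φ : DiagIFS d A) (ω : ℕ → Φ.Symb) : Fin d → ℝ :=
  fun i => ∑' n : ℕ, (∏ k ∈ Finset.range n, Φ.slope i ((ω k).1 i)) * Φ.off i ((ω n).1 i)

/-- the limit set `Λ_Φ = π(E^ℕ)` (the self-affine sponge) -/
def limitSet (Φ : DiagIFS d A) : Set (Fin d → ℝ) :=
  Set.range Φ.coding

theorem coding_mem (Φ : DiagIFS d A) (ω : ℕ → Φ.Symb) : Φ.coding ω ∈ Φ.limitSet :=
  ⟨ω, rfl⟩

/-- the `i`-th Lyapunov exponent `χ_i(p) = -∫ log|φ'_{a,i}| dp(a)` of a finite measure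
`p` on `E` (given by its density) -/
noncomputable def chi (Φ : DiagIFS d A) (i : Fin d) (p : Φ.Symb → ℝ) : ℝ :=
  -∑ a : Φ.Symb, p a * Real.log |Φ.slope i (a.1 i)|

/-- the mass `p([a]_I)` of the cylinder `[a]_I = {b ∈ E : b_i = a_i ∀ i ∈ I}` -/
noncomputable def cylMass (Φ : DiagIFS d A) (I : Finset (Fin d)) (p : Φ.Symb → ℝ)
    (a : Φ.Symb) : ℝ :=
  ∑ b : Φ.Symb, if ∀ i ∈ I, b.1 i = a.1 i then p b else 0

/-- the entropy `h(I; p) = -∫ log p([a]_I) dp(a)` -/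
noncomputable def entropy (Φ : DiagIFS d A) (I : Finset (Fin d)) (p : Φ.Symb → ℝ) : ℝ :=
  -∑ a : Φ.Symb, p a * Real.log (Φ.cylMass I p a)

/-- the conditional entropy `h(I' | I; p) = h(I';p) - h(I;p)` -/
noncomputable def condEntropy (Φ : DiagIFS d A) (I I' : Finset (Fin d))
    (p : Φ.Symb → ℝ) : ℝ :=
  Φ.entropy I' p - Φ.entropy I p

/-- a coordinate set `I ⊆ D` is good if the projected IFS `Φ_I` satisfies the open set
condition: the boxes `φ_{I,a}((0,1)^I)`, indexed by distinct projections of elements of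
`E`, are pairwise disjoint (equivalently, some coordinate has disjoint intervals). -/
def GoodIdx (Φ : DiagIFS d A) (I : Finset (Fin d)) : Prop :=
  ∀ a ∈ Φ.E, ∀ b ∈ Φ.E, (∃ i ∈ I, a i ≠ b i) →
    ∃ i ∈ I, Disjoint (Φ.base i (a i) '' Set.Ioo (0:ℝ) 1)
      (Φ.base i (b i) '' Set.Ioo (0:ℝ) 1)

/-- Barański condition: each base IFS satisfies the open set condition w.r.t. `(0,1)` -/
def Baranski (Φ : DiagIFS d A) : Prop :=
  ∀ i : Fin d, ∀ a b : A i, a ≠ b →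
    Disjoint (Φ.base i a '' Set.Ioo (0:ℝ) 1) (Φ.base i b '' Set.Ioo (0:ℝ) 1)

/-- strong Barański condition: each base IFS satisfies the strong separation condition
w.r.t. `[0,1]` -/
def StronglyBaranski (Φ : DiagIFS d A) : Prop :=
  ∀ i : Fin d, ∀ a b : A i, a ≠ b →
    Disjoint (Φ.base i a '' Set.Icc (0:ℝ) 1) (Φ.base i b '' Set.Icc (0:ℝ) 1)

/-- coordinate ordering condition: some permutation `σ` of the coordinates has
`|φ'_{a,σ(1)}| > ⋯ > |φ'_{a,σ(d)}|` for all `a ∈ E` -/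
def CoordOrdering (Φ : DiagIFS d A) : Prop :=
  ∃ σ : Equiv.Perm (Fin d), ∀ a ∈ Φ.E, ∀ i j : Fin d, i < j →
    |Φ.slope (σ j) (a (σ j))| < |Φ.slope (σ i) (a (σ i))|

end DiagIFS

/-- a probability vector (probability measure on a finite set, via its density) -/
def IsProbVec {α : Type*} [Fintype α] (p : α → ℝ) : Prop :=
  (∀ a, 0 ≤ p a) ∧ ∑ a, p a = 1

/-- a measure `p` on `E` is good if `I(p,x) = {i : χ_i(p) ≤ x}` is good for all `x > 0` -/
def DiagIFS.GoodVec (Φ : DiagIFS d A) (p : Φ.Symb → ℝ) : Prop :=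
  ∀ x > 0, Φ.GoodIdx (Finset.univ.filter fun i => Φ.chi i p ≤ x)

/-- a cycle on `E`: a continuous exponentially `λ`-periodic map `(0,∞) → P`,
where `λ = 1` means constant -/
structure Cycle (Φ : DiagIFS d A) where
  lam : ℝ
  one_le_lam : 1 ≤ lam
  r : ℝ → Φ.Symb → ℝ
  prob : ∀ b > 0, IsProbVec (r b)
  cont : ContinuousOn r (Set.Ioi 0)
  periodic : ∀ b > 0, r (lam * b) = r b
  const_of_lam_eq_one : lam = 1 → ∀ b > 0, ∀ b' > 0, r b = r b'

/-- the number `B_i`, determined by `B = ∫_0^{B_i} χ_i(r_b) db` (written via `sInf`;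
for a cycle the function `x ↦ ∫_0^x χ_i(r_b) db` is continuous and strictly
increasing, so the infimum is the unique solution) -/
noncomputable def Bcoord (Φ : DiagIFS d A) (r : ℝ → Φ.Symb → ℝ) (B : ℝ) (i : Fin d) : ℝ :=
  sInf {x : ℝ | 0 ≤ x ∧ B ≤ ∫ b in Set.Ioc (0:ℝ) x, Φ.chi i (r b)}

/-- `δ(r, B) = B⁻¹ ∫_0^∞ h({i : b ≤ B_i}; r_b) db` -/
noncomputable def deltaRB (Φ : DiagIFS d A) (r : ℝ → Φ.Symb → ℝ) (B : ℝ) : ℝ :=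
  B⁻¹ * ∫ b in Set.Ioi (0:ℝ),
    Φ.entropy (Finset.univ.filter fun i => b ≤ Bcoord Φ r B i) (r b)

/-- `δ(r) = inf_{B ∈ [1,λ]} δ(r,B)` -/
noncomputable def Cycle.delta {Φ : DiagIFS d A} (c : Cycle Φ) : ℝ :=
  sInf (deltaRB Φ c.r '' Set.Icc 1 c.lam)

/-- `δ(p) = ∫_0^∞ h({i : b ≤ 1/χ_i(p)}; p) db` -/
noncomputable def deltaP (Φ : DiagIFS d A) (p : Φ.Symb → ℝ) : ℝ :=
  ∫ b in Set.Ioi (0:ℝ),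
    Φ.entropy (Finset.univ.filter fun i => b ≤ (Φ.chi i p)⁻¹) p

/-- the normalized average `R̂_B = B⁻¹ ∫_0^B r_b db` of a cycle -/
noncomputable def cycleAvg {Φ : DiagIFS d A} (c : Cycle Φ) (B : ℝ) : Φ.Symb → ℝ :=
  fun a => B⁻¹ * ∫ b in Set.Ioc (0:ℝ) B, c.r b a

/-- a cycle is good if all its normalized averages `R̂_B` are good -/
def Cycle.Good {Φ : DiagIFS d A} (c : Cycle Φ) : Prop :=
  ∀ B > 0, Φ.GoodVec (cycleAvg c B)

/-- a cycle is nondegenerate if `{b > 0 : r_b(a) > 0 ∀ a ∈ E_r}` is dense in `(0,∞)` -/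
def Cycle.Nondeg {Φ : DiagIFS d A} (c : Cycle Φ) : Prop :=
  Set.Ioi (0:ℝ) ⊆
    closure {b : ℝ | 0 < b ∧ ∀ a : Φ.Symb, (∃ b' > 0, 0 < c.r b' a) → 0 < c.r b a}

/-- the lower pointwise dimension `d̲(x,μ) = liminf_{ρ→0} log μ(B(x,ρ))/log ρ` -/
noncomputable def lowerPtDim {X : Type*} [PseudoMetricSpace X] [MeasurableSpace X]
    (μ : Measure X) (x : X) : ℝ≥0∞ :=
  Filter.liminf
    (fun ρ : ℝ => ENNReal.ofReal (Real.log (μ (Metric.ball x ρ)).toReal / Real.log ρ))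
    (𝓝[>] (0:ℝ))

/-- the Hausdorff dimension of a measure: the essential supremum of its lower
pointwise dimension -/
noncomputable def measDim {X : Type*} [PseudoMetricSpace X] [MeasurableSpace X]
    (μ : Measure X) : ℝ≥0∞ :=
  essSup (lowerPtDim μ) μ

/-- the shift map on `E^ℕ` -/
def shift {α : Type*} (ω : ℕ → α) : ℕ → α := fun n => ω (n + 1)

/-- the dynamical dimension: the supremum of `HD(π_*μ)` over shift-invariant
probability measures `μ` on `E^ℕ` -/
noncomputable def DiagIFS.dynDim (Φ : DiagIFS d A) : ℝ≥0∞ :=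
  sSup {x : ℝ≥0∞ | ∃ μ : Measure (ℕ → Φ.Symb), IsProbabilityMeasure μ ∧
    Measure.map shift μ = μ ∧ x = measDim (Measure.map Φ.coding μ)}

/-- `μ` is the product measure on `E^ℕ` whose `k`-th factor has density `p k`
(this property characterizes `μ` uniquely) -/
def IsProductMeasure (Φ : DiagIFS d A) (p : ℕ → Φ.Symb → ℝ)
    (μ : Measure (ℕ → Φ.Symb)) : Prop :=
  IsProbabilityMeasure μ ∧
    ∀ (n : ℕ) (w : ℕ → Φ.Symb),
      (μ {ω | ∀ k < n, ω k = w k}).toReal = ∏ k ∈ Finset.range n, p k (w k)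

/-- the set of Hausdorff dimensions of Bernoulli measures `ν_p = π_*[p^ℕ]` -/
noncomputable def bernoulliDims (Φ : DiagIFS d A) : Set ℝ≥0∞ :=
  {x | ∃ p : Φ.Symb → ℝ, IsProbVec p ∧ ∃ μ : Measure (ℕ → Φ.Symb),
    IsProductMeasure Φ (fun _ => p) μ ∧ x = measDim (Measure.map Φ.coding μ)}

/-- the set of Hausdorff dimensions of pseudo-Bernoulli measures
`ν_r = π_*[∏_n r_n]` -/
noncomputable def pseudoBernoulliDims (Φ : DiagIFS d A) : Set ℝ≥0∞ :=
  {x | ∃ c : Cycle Φ, ∃ μ : Measure (ℕ → Φ.Symb),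
    IsProductMeasure Φ (fun n => c.r ((n : ℝ) + 1)) μ ∧
      x = measDim (Measure.map Φ.coding μ)}


section RealLemmas

/-- The infimum of the superlevel set of `x ↦ ∫₀ˣ f` moves by at most `η / m * B` when the
integrand `f` is replaced by some `g ≥ (1 - η) f` with `g ≥ m`. -/
theorem sInf_superlevel_le {f g : ℝ → ℝ} {m η B : ℝ} (hm : 0 < m) (hη : 0 ≤ η) (hη1 : η ≤ 1)
    (hB : 0 ≤ B) (hf : ∀ x, IntegrableOn f (Ioc 0 x)) (hg : ∀ x, IntegrableOn g (Ioc 0 x))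
    (hfm : ∀ b > 0, m ≤ f b) (hgm : ∀ b > 0, m ≤ g b) (hfg : ∀ b > 0, (1 - η) * f b ≤ g b) :
    sInf {x : ℝ | 0 ≤ x ∧ B ≤ ∫ b in Ioc (0:ℝ) x, g b} ≤
      sInf {x : ℝ | 0 ≤ x ∧ B ≤ ∫ b in Ioc (0:ℝ) x, f b} + η / m * B := by
  have hne : {x : ℝ | 0 ≤ x ∧ B ≤ ∫ b in Ioc (0:ℝ) x, f b}.Nonempty := by
    have h0 : 0 ≤ B / m := by positivity
    refine ⟨B / m, h0, ?_⟩
    have := setIntegral_mono_on (s := Ioc 0 (B / m)) (f := fun _ => m) (g := f)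
      (by simp) (hf _) measurableSet_Ioc (fun b hb => hfm b hb.1)
    have h2 : B / m * m = B := by field_simp
    simpa [h0, h2] using this
  rw [← sub_le_iff_le_add]
  refine le_csInf hne ?_
  rintro x ⟨hx0, hx⟩
  rw [sub_le_iff_le_add]
  have hc : 0 ≤ η / m * B := by positivity
  refine csInf_le ⟨0, fun y hy => hy.1⟩ ⟨by positivity, ?_⟩
  have hsplit : ∫ b in Ioc (0:ℝ) (x + η / m * B), g b =
      (∫ b in Ioc (0:ℝ) x, g b) + ∫ b in Ioc x (x + η / m * B), g b := by
    rw [← setIntegral_union _ measurableSet_Ioc (hg x)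
      ((hg (x + η / m * B)).mono_set (Ioc_subset_Ioc_left hx0)),
      Ioc_union_Ioc_eq_Ioc hx0 (by linarith)]
    exact Set.disjoint_left.2 fun y hy hy' => not_lt.2 hy.2 hy'.1
  have h1 : (1 - η) * B ≤ ∫ b in Ioc (0:ℝ) x, g b := by
    have := setIntegral_mono_on (s := Ioc 0 x) (f := fun b => (1 - η) * f b) (g := g)
      ((hf x).const_mul _) (hg x) measurableSet_Ioc (fun b hb => hfg b hb.1)
    rw [integral_const_mul] at this
    exact (mul_le_mul_of_nonneg_left hx (by linarith)).trans this
  have h2 : η * B ≤ ∫ b in Ioc x (x + η / m * B), g b := by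
    have := setIntegral_mono_on (s := Ioc x (x + η / m * B)) (f := fun _ => m) (g := g)
      (by simp) ((hg (x + η / m * B)).mono_set (Ioc_subset_Ioc_left hx0)) measurableSet_Ioc
      (fun b hb => hgm b (hx0.trans_lt hb.1))
    have h3 : η / m * B * m = η * B := by field_simp
    simpa [hc, h3] using this
  rw [hsplit]
  linarith

/-- The infimum of the superlevel set of `x ↦ ∫₀ˣ f` is at most `B / m` if `f ≥ m`. -/
theorem sInf_superlevel_mem_Icc {f : ℝ → ℝ} {m B : ℝ} (hm : 0 < m) (hB : 0 ≤ B)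
    (hf : ∀ x, IntegrableOn f (Ioc 0 x)) (hfm : ∀ b > 0, m ≤ f b) :
    sInf {x : ℝ | 0 ≤ x ∧ B ≤ ∫ b in Ioc (0:ℝ) x, f b} ∈ Icc 0 (B / m) := by
  have h0 : 0 ≤ B / m := by positivity
  refine ⟨Real.sInf_nonneg fun y hy => hy.1, csInf_le ⟨0, fun y hy => hy.1⟩ ⟨h0, ?_⟩⟩
  have := setIntegral_mono_on (s := Ioc 0 (B / m)) (f := fun _ => m) (g := f)
    (by simp) (hf _) measurableSet_Ioc (fun b hb => hfm b hb.1)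
  have h2 : B / m * m = B := by field_simp
  simpa [h0, h2] using this

theorem abs_iSup_sub_iSup_le {ι : Type*} [Nonempty ι] {f g : ι → ℝ} {ε : ℝ}
    (hf : BddAbove (range f)) (hg : BddAbove (range g)) (h : ∀ i, |f i - g i| ≤ ε) :
    |(⨆ i, f i) - ⨆ i, g i| ≤ ε := by
  have h' := fun i => abs_sub_le_iff.1 (h i)
  rw [abs_sub_le_iff, sub_le_iff_le_add', sub_le_iff_le_add']
  exact ⟨ciSup_le fun i => by linarith [(h' i).1, le_ciSup hg i],
    ciSup_le fun i => by linarith [(h' i).2, le_ciSup hf i]⟩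

theorem abs_sInf_image_sub_sInf_image_le {ι : Type*} {s : Set ι} (hs : s.Nonempty)
    {f g : ι → ℝ} {ε : ℝ} (hf : BddBelow (f '' s)) (hg : BddBelow (g '' s))
    (h : ∀ i ∈ s, |f i - g i| ≤ ε) :
    |sInf (f '' s) - sInf (g '' s)| ≤ ε := by
  have h' := fun i hi => abs_sub_le_iff.1 (h i hi)
  rw [abs_sub_le_iff, sub_le_comm, sub_le_comm (a := sInf (g '' s))]
  constructor
  · refine le_csInf (hs.image g) ?_
    rintro _ ⟨i, hi, rfl⟩
    linarith [(h' i hi).1, csInf_le hf (mem_image_of_mem f hi)]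
  · refine le_csInf (hs.image f) ?_
    rintro _ ⟨i, hi, rfl⟩
    linarith [(h' i hi).2, csInf_le hg (mem_image_of_mem g hi)]

end RealLemmas

section Entropy

variable {d : ℕ} {A : Fin d → Type} [∀ i, Fintype (A i)]

theorem IsProbVec.le_one {α : Type*} [Fintype α] {p : α → ℝ} (hp : IsProbVec p) (a : α) :
    p a ≤ 1 :=
  hp.2 ▸ Finset.single_le_sum (fun b _ => hp.1 b) (Finset.mem_univ a)

theorem DiagIFS.abs_entropy_le (Φ : DiagIFS d A) (I : Finset (Fin d)) {p : Φ.Symb → ℝ}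
    (hp : IsProbVec p) : |Φ.entropy I p| ≤ Fintype.card Φ.Symb := by
  rw [DiagIFS.entropy, abs_neg]
  refine (Finset.abs_sum_le_sum_abs _ _).trans ?_
  have key : ∀ a : Φ.Symb, |p a * Real.log (Φ.cylMass I p a)| ≤ 1 := by
    intro a
    rcases (hp.1 a).eq_or_lt with h0 | h0
    · simp [← h0]
    have hnn : ∀ b : Φ.Symb, 0 ≤ if ∀ i ∈ I, b.1 i = a.1 i then p b else 0 := fun b => by
      split_ifs
      exacts [hp.1 b, le_rfl]
    have hle : p a ≤ Φ.cylMass I p a := by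
      have := Finset.single_le_sum (fun b _ => hnn b) (Finset.mem_univ a)
      simpa [DiagIFS.cylMass] using this
    have hle1 : Φ.cylMass I p a ≤ 1 := by
      rw [← hp.2]
      refine Finset.sum_le_sum fun b _ => ?_
      split_ifs
      exacts [le_rfl, hp.1 b]
    have hlog : Real.log (p a) ≤ Real.log (Φ.cylMass I p a) := Real.log_le_log h0 hle
    have hlog0 : Real.log (Φ.cylMass I p a) ≤ 0 := Real.log_nonpos (h0.le.trans hle) hle1
    have hb := Real.abs_log_mul_self_lt (p a) h0 (hp.le_one a)
    rw [abs_mul, abs_of_pos h0, abs_of_nonpos hlog0]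
    rw [abs_mul, abs_of_pos h0, abs_of_nonpos (hlog.trans hlog0)] at hb
    nlinarith
  exact (Finset.sum_le_sum fun a _ => key a).trans (by simp)

theorem DiagIFS.entropy_empty (Φ : DiagIFS d A) {p : Φ.Symb → ℝ} (hp : IsProbVec p) :
    Φ.entropy ∅ p = 0 := by
  have h : ∀ a, Φ.cylMass ∅ p a = 1 := fun a => by
    rw [← hp.2]
    exact Finset.sum_congr rfl fun b _ => if_pos (by simp)
  simp only [DiagIFS.entropy, h, Real.log_one, mul_zero, Finset.sum_const_zero, neg_zero]

theorem DiagIFS.measurable_entropy (Φ : DiagIFS d A) (I : Finset (Fin d)) :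
    Measurable (Φ.entropy I) := by
  have hcyl : ∀ a, Measurable fun p : Φ.Symb → ℝ => Φ.cylMass I p a := fun a =>
    Finset.measurable_sum _ fun b _ => by
      by_cases h : ∀ i ∈ I, b.1 i = a.1 i
      · simp only [if_pos h]
        exact measurable_pi_apply b
      · simp only [if_neg h]
        exact measurable_const
  have hterm : ∀ a, Measurable fun p : Φ.Symb → ℝ => p a * Real.log (Φ.cylMass I p a) :=
    fun a => (measurable_pi_apply a).mul (Real.measurable_log.comp (hcyl a))
  exact (Finset.measurable_sum _ fun a _ => hterm a).neg

variable (Φ : DiagIFS d A) {r : ℝ → Φ.Symb → ℝ}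

theorem DiagIFS.integrableOn_entropy_filter (hr : ∀ b > 0, IsProbVec (r b))
    (hc : ContinuousOn r (Ioi 0)) (β : Fin d → ℝ) :
    IntegrableOn (fun b => Φ.entropy (Finset.univ.filter fun i => b ≤ β i) (r b)) (Ioi 0) := by
  obtain ⟨M, hM⟩ : ∃ M, ∀ i, β i ≤ M := by
    obtain ⟨M, hM⟩ := (finite_range β).bddAbove
    exact ⟨M, fun i => hM (mem_range_self i)⟩
  have hmeas : AEStronglyMeasurable
      (fun b => Φ.entropy (Finset.univ.filter fun i => b ≤ β i) (r b))
      (volume.restrict (Ioi 0)) := by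
    have hsum : (fun b => Φ.entropy (Finset.univ.filter fun i => b ≤ β i) (r b)) =
        fun b => ∑ I : Finset (Fin d),
          {b : ℝ | (Finset.univ.filter fun i => b ≤ β i) = I}.indicator
            (fun b => Φ.entropy I (r b)) b := by
      funext b
      simp [Set.indicator_apply]
    rw [hsum]
    refine Finset.aestronglyMeasurable_fun_sum _ fun I _ => ?_
    refine AEStronglyMeasurable.indicator ?_ ?_
    · exact ((Φ.measurable_entropy I).comp_aemeasurable
        (hc.aemeasurable measurableSet_Ioi)).aestronglyMeasurable
    · have hset : {b : ℝ | (Finset.univ.filter fun i => b ≤ β i) = I} =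
          ⋂ i, {b : ℝ | b ≤ β i ↔ i ∈ I} := by
        ext b
        simp [Finset.ext_iff]
      rw [hset]
      exact MeasurableSet.iInter fun i => measurableSet_Iic.iff (.const _)
  have hbd : IntegrableOn ((Ioc 0 M).indicator fun _ : ℝ => (Fintype.card Φ.Symb : ℝ))
      (Ioi 0) :=
    ((integrable_indicator_iff measurableSet_Ioc).2 (by simp)).integrableOn
  refine Integrable.mono' hbd hmeas ?_
  filter_upwards [ae_restrict_mem measurableSet_Ioi] with b hb
  by_cases hbM : b ≤ M
  · rw [indicator_of_mem (show b ∈ Ioc 0 M from ⟨hb, hbM⟩)]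
    exact Φ.abs_entropy_le _ (hr b hb)
  · have : (Finset.univ.filter fun i => b ≤ β i) = ∅ := by
      ext i
      simpa using (hM i).trans_lt (not_le.1 hbM)
    rw [this, Φ.entropy_empty (hr b hb), norm_zero]
    exact indicator_nonneg (fun _ _ => by positivity) _

/-- The integrated entropy depends Lipschitz continuously on the truncation levels. -/
theorem DiagIFS.abs_integral_entropy_sub_le (hr : ∀ b > 0, IsProbVec (r b))
    (hc : ContinuousOn r (Ioi 0)) {β γ : Fin d → ℝ} {ε : ℝ} (h : ∀ i, |β i - γ i| ≤ ε) :
    |(∫ b in Ioi (0:ℝ), Φ.entropy (Finset.univ.filter fun i => b ≤ β i) (r b)) -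
      ∫ b in Ioi (0:ℝ), Φ.entropy (Finset.univ.filter fun i => b ≤ γ i) (r b)| ≤
      2 * Fintype.card Φ.Symb * (d * ε) := by
  rw [← integral_sub (Φ.integrableOn_entropy_filter hr hc β)
    (Φ.integrableOn_entropy_filter hr hc γ)]
  set C : ℝ := (Fintype.card Φ.Symb : ℝ)
  have hC : 0 ≤ C := by positivity
  have hint : ∀ i, Integrable ((uIoc (γ i) (β i)).indicator fun _ : ℝ => 2 * C) := fun i =>
    (integrable_indicator_iff measurableSet_uIoc).2
      (integrableOn_const (by simp [uIoc]))
  have hnn : ∀ i b, 0 ≤ (uIoc (γ i) (β i)).indicator (fun _ : ℝ => 2 * C) b := fun i b =>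
    indicator_nonneg (fun _ _ => by positivity) _
  have hpt : ∀ b ∈ Ioi (0:ℝ),
      ‖Φ.entropy (Finset.univ.filter fun i => b ≤ β i) (r b) -
        Φ.entropy (Finset.univ.filter fun i => b ≤ γ i) (r b)‖ ≤
      ∑ i, (uIoc (γ i) (β i)).indicator (fun _ : ℝ => 2 * C) b := by
    intro b hb
    by_cases hex : ∃ i, b ∈ uIoc (γ i) (β i)
    · obtain ⟨i, hi⟩ := hex
      have h1 := Finset.single_le_sum (fun j _ => hnn j b) (Finset.mem_univ i)
      rw [indicator_of_mem hi] at h1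
      refine le_trans ?_ h1
      refine (norm_sub_le _ _).trans ?_
      rw [Real.norm_eq_abs, Real.norm_eq_abs]
      linarith [Φ.abs_entropy_le (Finset.univ.filter fun i => b ≤ β i) (hr b hb),
        Φ.abs_entropy_le (Finset.univ.filter fun i => b ≤ γ i) (hr b hb)]
    · have heq : (Finset.univ.filter fun i => b ≤ β i) =
          Finset.univ.filter fun i => b ≤ γ i := by
        refine Finset.filter_congr fun i _ => ?_
        by_contra hne
        refine hex ⟨i, ?_⟩
        rw [mem_uIoc]
        grind
      rw [heq, sub_self, norm_zero]
      exact Finset.sum_nonneg fun i _ => hnn i b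
  have hsum : Integrable fun b => ∑ i, (uIoc (γ i) (β i)).indicator (fun _ : ℝ => 2 * C) b :=
    integrable_finsetSum _ fun i _ => hint i
  rw [← Real.norm_eq_abs]
  refine (norm_integral_le_of_norm_le hsum.integrableOn
    ((ae_restrict_iff' measurableSet_Ioi).2 (.of_forall hpt))).trans ?_
  refine (setIntegral_le_integral hsum
    (.of_forall fun b => Finset.sum_nonneg fun i _ => hnn i b)).trans ?_
  rw [integral_finsetSum _ fun i _ => hint i]
  have hi : ∀ i, ∫ b, (uIoc (γ i) (β i)).indicator (fun _ : ℝ => 2 * C) b ≤ ε * (2 * C) := by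
    intro i
    rw [integral_indicator measurableSet_uIoc, setIntegral_const, smul_eq_mul,
      measureReal_def, Real.volume_uIoc, ENNReal.toReal_ofReal (abs_nonneg _)]
    exact mul_le_mul_of_nonneg_right (h i) (by positivity)
  refine (Finset.sum_le_sum fun i _ => hi i).trans (le_of_eq ?_)
  simp
  ring

/-- The integrated entropy is bounded in terms of the truncation levels. -/
theorem DiagIFS.abs_integral_entropy_le (hr : ∀ b > 0, IsProbVec (r b))
    (hc : ContinuousOn r (Ioi 0)) {β : Fin d → ℝ} {ε : ℝ} (h : ∀ i, |β i| ≤ ε) :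
    |∫ b in Ioi (0:ℝ), Φ.entropy (Finset.univ.filter fun i => b ≤ β i) (r b)| ≤
      2 * Fintype.card Φ.Symb * (d * ε) := by
  have h0 : ∫ b in Ioi (0:ℝ),
      Φ.entropy (Finset.univ.filter fun i : Fin d => b ≤ (fun _ => (0:ℝ)) i) (r b) = 0 := by
    refine setIntegral_eq_zero_of_forall_eq_zero fun b hb => ?_
    have : (Finset.univ.filter fun i : Fin d => b ≤ (fun _ => (0:ℝ)) i) = ∅ := by
      refine Finset.filter_eq_empty_iff.2 fun i _ => not_le.2 ?_
      exact hb
    rw [this, Φ.entropy_empty (hr b hb)]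
  have := Φ.abs_integral_entropy_sub_le hr hc (β := β) (γ := fun _ => 0) (ε := ε)
    (by simpa using h)
  rwa [h0, sub_zero] at this

end Entropy

section Lyapunov

variable {d : ℕ} {A : Fin d → Type} [∀ i, Fintype (A i)]

/-- all the base maps have logarithmic contraction rate at least `m` -/
def DiagIFS.ContractsBy (Φ : DiagIFS d A) (m : ℝ) : Prop :=
  ∀ i a, m ≤ -Real.log |Φ.slope i a|

theorem DiagIFS.ContractsBy.le_chi {Φ : DiagIFS d A} {m : ℝ} (h : Φ.ContractsBy m)
    (i : Fin d) {p : Φ.Symb → ℝ} (hp : IsProbVec p) : m ≤ Φ.chi i p := by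
  calc m = ∑ a, p a * m := by rw [← Finset.sum_mul, hp.2, one_mul]
    _ ≤ ∑ a, p a * -Real.log |Φ.slope i (a.1 i)| :=
      Finset.sum_le_sum fun a _ => mul_le_mul_of_nonneg_left (h i _) (hp.1 a)
    _ = Φ.chi i p := by simp [DiagIFS.chi]

theorem DiagIFS.continuous_chi (Φ : DiagIFS d A) (i : Fin d) : Continuous (Φ.chi i) := by
  unfold DiagIFS.chi
  fun_prop

theorem DiagIFS.abs_chi_le (Φ : DiagIFS d A) (i : Fin d) {p : Φ.Symb → ℝ}
    (hp : IsProbVec p) : |Φ.chi i p| ≤ ∑ a : Φ.Symb, |Real.log (|Φ.slope i (a.1 i)|)| := by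
  rw [DiagIFS.chi, abs_neg]
  refine (Finset.abs_sum_le_sum_abs _ _).trans (Finset.sum_le_sum fun a _ => ?_)
  rw [abs_mul, abs_of_nonneg (hp.1 a)]
  exact mul_le_of_le_one_left (abs_nonneg _) (hp.le_one a)

theorem DiagIFS.integrableOn_chi (Φ : DiagIFS d A) {r : ℝ → Φ.Symb → ℝ}
    (hr : ∀ b > 0, IsProbVec (r b)) (hc : ContinuousOn r (Ioi 0)) (i : Fin d) (x : ℝ) :
    IntegrableOn (fun b => Φ.chi i (r b)) (Ioc 0 x) := by
  refine IntegrableOn.of_bound (by simp)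
    ((((Φ.continuous_chi i).comp_continuousOn hc).mono
      fun b hb => hb.1).aestronglyMeasurable measurableSet_Ioc)
    (∑ a : Φ.Symb, |Real.log (|Φ.slope i (a.1 i)|)|) ?_
  filter_upwards [ae_restrict_mem measurableSet_Ioc] with b hb
  exact Φ.abs_chi_le i (hr b hb.1)

theorem DiagIFS.ContractsBy.abs_deltaRB_le {Φ : DiagIFS d A} {m : ℝ} (h : Φ.ContractsBy m)
    (hm : 0 < m) {r : ℝ → Φ.Symb → ℝ} (hr : ∀ b > 0, IsProbVec (r b))
    (hc : ContinuousOn r (Ioi 0)) {B : ℝ} (hB : 0 < B) :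
    |deltaRB Φ r B| ≤ 2 * Fintype.card Φ.Symb * (d / m) := by
  have hle : ∀ i, |Bcoord Φ r B i| ≤ B / m := fun i => by
    have := sInf_superlevel_mem_Icc hm hB.le (Φ.integrableOn_chi hr hc i)
      fun b hb => h.le_chi i (hr b hb)
    exact (abs_of_nonneg this.1).trans_le this.2
  rw [deltaRB, abs_mul, abs_of_pos (inv_pos.2 hB)]
  refine (mul_le_mul_of_nonneg_left (Φ.abs_integral_entropy_le hr hc hle)
    (inv_pos.2 hB).le).trans (le_of_eq ?_)
  field_simp

theorem DiagIFS.ContractsBy.abs_deltaP_le {Φ : DiagIFS d A} {m : ℝ} (h : Φ.ContractsBy m)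
    (hm : 0 < m) {p : Φ.Symb → ℝ} (hp : IsProbVec p) :
    |deltaP Φ p| ≤ 2 * Fintype.card Φ.Symb * (d / m) := by
  have hle : ∀ i, |(Φ.chi i p)⁻¹| ≤ m⁻¹ := fun i => by
    have := h.le_chi i hp
    rw [abs_of_pos (inv_pos.2 (hm.trans_le this))]
    exact inv_anti₀ hm this
  exact Φ.abs_integral_entropy_le (r := fun _ => p) (fun _ _ => hp) continuousOn_const hle

theorem DiagIFS.ContractsBy.bddBelow_deltaRB {Φ : DiagIFS d A} {m : ℝ} (h : Φ.ContractsBy m)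
    (hm : 0 < m) (c : Cycle Φ) : BddBelow (deltaRB Φ c.r '' Icc 1 c.lam) := by
  refine ⟨-(2 * Fintype.card Φ.Symb * (d / m)), ?_⟩
  rintro _ ⟨B, hB, rfl⟩
  exact (abs_le.1 (h.abs_deltaRB_le hm c.prob c.cont (one_pos.trans_le hB.1))).1

theorem DiagIFS.ContractsBy.bddAbove_delta {Φ : DiagIFS d A} {m : ℝ} (h : Φ.ContractsBy m)
    (hm : 0 < m) : BddAbove (range (Cycle.delta (Φ := Φ))) := by
  refine ⟨2 * Fintype.card Φ.Symb * (d / m), ?_⟩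
  rintro _ ⟨c, rfl⟩
  refine (csInf_le (h.bddBelow_deltaRB hm c)
    (mem_image_of_mem _ (left_mem_Icc.2 c.one_le_lam))).trans ?_
  exact (abs_le.1 (h.abs_deltaRB_le hm c.prob c.cont one_pos)).2

theorem DiagIFS.ContractsBy.bddAbove_deltaP {Φ : DiagIFS d A} {m : ℝ} (h : Φ.ContractsBy m)
    (hm : 0 < m) :
    BddAbove (range fun p : {p : Φ.Symb → ℝ // IsProbVec p} => deltaP Φ p) := by
  refine ⟨2 * Fintype.card Φ.Symb * (d / m), ?_⟩
  rintro _ ⟨p, rfl⟩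
  exact (abs_le.1 (h.abs_deltaP_le hm p.2)).2

end Lyapunov

section Comparison

variable {d : ℕ} {A : Fin d → Type} [∀ i, Fintype (A i)] {E : Finset (∀ i, A i)}
  {s s' t t' : ∀ i, A i → ℝ} {m η : ℝ}

theorem abs_chi_sub_chi_le (hss : ∀ i a, |Real.log |s i a| - Real.log (|s' i a|)| ≤ η)
    (i : Fin d) {p : (DiagIFS.mk s t E).Symb → ℝ} (hp : IsProbVec p) :
    |(DiagIFS.mk s t E).chi i p - (DiagIFS.mk s' t' E).chi i p| ≤ η := by
  have : (DiagIFS.mk s t E).chi i p - (DiagIFS.mk s' t' E).chi i p =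
      -∑ a : (DiagIFS.mk s t E).Symb,
        p a * (Real.log |s i (a.1 i)| - Real.log |s' i (a.1 i)|) := by
    simp only [DiagIFS.chi, mul_sub, Finset.sum_sub_distrib]
    ring
  rw [this, abs_neg]
  calc |∑ a, p a * (Real.log |s i (a.1 i)| - Real.log |s' i (a.1 i)|)|
      ≤ ∑ a, |p a * (Real.log |s i (a.1 i)| - Real.log |s' i (a.1 i)|)| :=
        Finset.abs_sum_le_sum_abs _ _
    _ ≤ ∑ a, p a * η := Finset.sum_le_sum fun a _ => by
        rw [abs_mul, abs_of_nonneg (hp.1 a)]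
        exact mul_le_mul_of_nonneg_left (hss i _) (hp.1 a)
    _ = η := by rw [← Finset.sum_mul, hp.2, one_mul]

theorem Bcoord_le_add (hm : 0 < m) (hη : 0 ≤ η) (hη1 : η ≤ 1)
    (hs : (DiagIFS.mk s t E).ContractsBy m) (hs' : (DiagIFS.mk s' t' E).ContractsBy m)
    (hss : ∀ i a, |Real.log |s i a| - Real.log (|s' i a|)| ≤ η * m)
    {r : ℝ → (DiagIFS.mk s t E).Symb → ℝ} (hr : ∀ b > 0, IsProbVec (r b))
    (hc : ContinuousOn r (Ioi 0)) {B : ℝ} (hB : 0 ≤ B) (i : Fin d) :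
    Bcoord (DiagIFS.mk s' t' E) r B i ≤ Bcoord (DiagIFS.mk s t E) r B i + η / m * B := by
  refine sInf_superlevel_le hm hη hη1 hB
    ((DiagIFS.mk s t E).integrableOn_chi hr hc i)
    ((DiagIFS.mk s' t' E).integrableOn_chi hr hc i)
    (fun b hb => hs.le_chi i (hr b hb)) (fun b hb => hs'.le_chi i (hr b hb)) fun b hb => ?_
  have h1 := abs_le.1 (abs_chi_sub_chi_le (t := t) (t' := t') hss i (hr b hb))
  have h2 := mul_le_mul_of_nonneg_left (hs.le_chi i (hr b hb)) hη
  linarith [h1.2]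

theorem abs_deltaRB_sub_deltaRB_le (hm : 0 < m) (hη : 0 ≤ η) (hη1 : η ≤ 1)
    (hs : (DiagIFS.mk s t E).ContractsBy m) (hs' : (DiagIFS.mk s' t' E).ContractsBy m)
    (hss : ∀ i a, |Real.log |s i a| - Real.log (|s' i a|)| ≤ η * m)
    {r : ℝ → (DiagIFS.mk s t E).Symb → ℝ} (hr : ∀ b > 0, IsProbVec (r b))
    (hc : ContinuousOn r (Ioi 0)) {B : ℝ} (hB : 0 < B) :
    |deltaRB (DiagIFS.mk s t E) r B - deltaRB (DiagIFS.mk s' t' E) r B| ≤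
      2 * E.card * (d / m) * η := by
  have hss' : ∀ i a, |Real.log |s' i a| - Real.log (|s i a|)| ≤ η * m := fun i a => by
    rw [abs_sub_comm]
    exact hss i a
  have hle : ∀ i, |Bcoord (DiagIFS.mk s t E) r B i - Bcoord (DiagIFS.mk s' t' E) r B i| ≤
      η / m * B := fun i => by
    rw [abs_sub_le_iff, sub_le_iff_le_add', sub_le_iff_le_add']
    exact ⟨Bcoord_le_add hm hη hη1 hs' hs hss' hr hc hB.le i,
      Bcoord_le_add hm hη hη1 hs hs' hss hr hc hB.le i⟩
  have hint := (DiagIFS.mk s t E).abs_integral_entropy_sub_le hr hc hle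
  have heq : deltaRB (DiagIFS.mk s' t' E) r B = B⁻¹ * ∫ b in Ioi (0:ℝ),
      (DiagIFS.mk s t E).entropy
        (Finset.univ.filter fun i => b ≤ Bcoord (DiagIFS.mk s' t' E) r B i) (r b) := rfl
  rw [heq, deltaRB, ← mul_sub, abs_mul, abs_of_pos (inv_pos.2 hB)]
  refine (mul_le_mul_of_nonneg_left hint (inv_pos.2 hB).le).trans (le_of_eq ?_)
  have hcard : Fintype.card (DiagIFS.mk s t E).Symb = E.card := Fintype.card_coe E
  rw [hcard]
  field_simp

theorem abs_deltaP_sub_deltaP_le (hm : 0 < m) (hη : 0 ≤ η)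
    (hs : (DiagIFS.mk s t E).ContractsBy m) (hs' : (DiagIFS.mk s' t' E).ContractsBy m)
    (hss : ∀ i a, |Real.log |s i a| - Real.log (|s' i a|)| ≤ η * m)
    {p : (DiagIFS.mk s t E).Symb → ℝ} (hp : IsProbVec p) :
    |deltaP (DiagIFS.mk s t E) p - deltaP (DiagIFS.mk s' t' E) p| ≤
      2 * E.card * (d / m) * η := by
  have hle : ∀ i, |((DiagIFS.mk s t E).chi i p)⁻¹ - ((DiagIFS.mk s' t' E).chi i p)⁻¹| ≤
      η / m := fun i => by
    have h1 := hs.le_chi i hp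
    have h2 := hs'.le_chi i hp
    have h3 := abs_chi_sub_chi_le (t := t) (t' := t') hss i hp
    have p1 := hm.trans_le h1
    have p2 := hm.trans_le h2
    rw [inv_sub_inv p1.ne' p2.ne', abs_div, abs_sub_comm, abs_of_pos (mul_pos p1 p2)]
    calc _ ≤ η * m / (m * m) :=
          div_le_div₀ (by positivity) h3 (by positivity) (mul_le_mul h1 h2 hm.le p1.le)
      _ = η / m := by field_simp
  have hint := (DiagIFS.mk s t E).abs_integral_entropy_sub_le (r := fun _ => p)
    (fun _ _ => hp) continuousOn_const hle
  have hcard : Fintype.card (DiagIFS.mk s t E).Symb = E.card := Fintype.card_coe E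
  refine hint.trans (le_of_eq ?_)
  rw [hcard]
  ring

/-- a cycle of one IFS seen as a cycle of another IFS with the same alphabet -/
def Cycle.transfer (c : Cycle (DiagIFS.mk s t E)) (s' t' : ∀ i, A i → ℝ) :
    Cycle (DiagIFS.mk s' t' E) :=
  ⟨c.lam, c.one_le_lam, c.r, c.prob, c.cont, c.periodic, c.const_of_lam_eq_one⟩

theorem abs_delta_sub_delta_transfer_le (hm : 0 < m) (hη : 0 ≤ η) (hη1 : η ≤ 1)
    (hs : (DiagIFS.mk s t E).ContractsBy m) (hs' : (DiagIFS.mk s' t' E).ContractsBy m)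
    (hss : ∀ i a, |Real.log |s i a| - Real.log (|s' i a|)| ≤ η * m)
    (c : Cycle (DiagIFS.mk s t E)) :
    |c.delta - (c.transfer s' t').delta| ≤ 2 * E.card * (d / m) * η :=
  abs_sInf_image_sub_sInf_image_le (nonempty_Icc.2 c.one_le_lam)
    (hs.bddBelow_deltaRB hm c) (hs'.bddBelow_deltaRB hm (c.transfer s' t')) fun _ hB =>
    abs_deltaRB_sub_deltaRB_le hm hη hη1 hs hs' hss c.prob c.cont (one_pos.trans_le hB.1)

theorem exists_isProbVec {α : Type*} [Fintype α] [Nonempty α] :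
    ∃ p : α → ℝ, IsProbVec p := by
  obtain ⟨a⟩ := ‹Nonempty α›
  refine ⟨Pi.single a 1, fun b => ?_, by simp⟩
  by_cases h : b = a
  · subst h
    simp
  · simp [h]

theorem nonempty_cycle (Φ : DiagIFS d A) (hE : Φ.E.Nonempty) : Nonempty (Cycle Φ) := by
  have : Nonempty Φ.Symb := hE.to_subtype
  obtain ⟨p, hp⟩ := exists_isProbVec (α := Φ.Symb)
  exact ⟨⟨1, le_rfl, fun _ => p, fun _ _ => hp, continuousOn_const, fun _ _ => rfl,
    fun _ _ _ _ _ => rfl⟩⟩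

theorem abs_sSup_delta_sub_le (hE : E.Nonempty) (hm : 0 < m) (hη : 0 ≤ η) (hη1 : η ≤ 1)
    (hs : (DiagIFS.mk s t E).ContractsBy m) (hs' : (DiagIFS.mk s' t' E).ContractsBy m)
    (hss : ∀ i a, |Real.log |s i a| - Real.log (|s' i a|)| ≤ η * m) :
    |sSup {x : ℝ | ∃ c : Cycle (DiagIFS.mk s t E), x = c.delta} -
      sSup {x : ℝ | ∃ c : Cycle (DiagIFS.mk s' t' E), x = c.delta}| ≤
      2 * E.card * (d / m) * η := by
  have : Nonempty (Cycle (DiagIFS.mk s t E)) := nonempty_cycle _ hE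
  have h1 : {x : ℝ | ∃ c : Cycle (DiagIFS.mk s t E), x = c.delta} =
      range fun c : Cycle (DiagIFS.mk s t E) => c.delta := by
    ext x
    simp [eq_comm]
  have h2 : {x : ℝ | ∃ c : Cycle (DiagIFS.mk s' t' E), x = c.delta} =
      range fun c : Cycle (DiagIFS.mk s t E) => (c.transfer s' t').delta := by
    ext x
    exact ⟨fun ⟨c, hc⟩ => ⟨c.transfer s t, hc.symm⟩, fun ⟨c, hc⟩ => ⟨_, hc.symm⟩⟩
  have hbd : BddAbove (range fun c : Cycle (DiagIFS.mk s t E) => (c.transfer s' t').delta) :=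
    (hs'.bddAbove_delta hm).mono <| by
      rintro _ ⟨c, rfl⟩
      exact ⟨c.transfer s' t', rfl⟩
  rw [h1, h2]
  exact abs_iSup_sub_iSup_le (hs.bddAbove_delta hm) hbd
    (abs_delta_sub_delta_transfer_le hm hη hη1 hs hs' hss)

theorem abs_sSup_deltaP_sub_le (hE : E.Nonempty) (hm : 0 < m) (hη : 0 ≤ η)
    (hs : (DiagIFS.mk s t E).ContractsBy m) (hs' : (DiagIFS.mk s' t' E).ContractsBy m)
    (hss : ∀ i a, |Real.log |s i a| - Real.log (|s' i a|)| ≤ η * m) :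
    |sSup {x : ℝ | ∃ p : (DiagIFS.mk s t E).Symb → ℝ, IsProbVec p ∧
        x = deltaP (DiagIFS.mk s t E) p} -
      sSup {x : ℝ | ∃ p : (DiagIFS.mk s' t' E).Symb → ℝ, IsProbVec p ∧
        x = deltaP (DiagIFS.mk s' t' E) p}| ≤
      2 * E.card * (d / m) * η := by
  have : Nonempty (DiagIFS.mk s t E).Symb := hE.to_subtype
  have : Nonempty {p : (DiagIFS.mk s t E).Symb → ℝ // IsProbVec p} :=
    nonempty_subtype.2 exists_isProbVec
  have h : ∀ u v : ∀ i, A i → ℝ, {x : ℝ | ∃ p : (DiagIFS.mk u v E).Symb → ℝ, IsProbVec p ∧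
      x = deltaP (DiagIFS.mk u v E) p} =
      range fun p : {p : (DiagIFS.mk u v E).Symb → ℝ // IsProbVec p} =>
        deltaP (DiagIFS.mk u v E) p := by
    intro u v
    ext x
    exact ⟨fun ⟨p, hp, hx⟩ => ⟨⟨p, hp⟩, hx.symm⟩, fun ⟨p, hx⟩ => ⟨p, p.2, hx.symm⟩⟩
  rw [h, h]
  exact abs_iSup_sub_iSup_le (hs.bddAbove_deltaP hm) (hs'.bddAbove_deltaP hm)
    fun p => abs_deltaP_sub_deltaP_le hm hη hs hs' hss p.2

/-- Around a valid diagonal IFS the logarithmic contraction rates are bounded below by some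
`m > 0`, and vary by an arbitrarily small multiple of `m`. -/
theorem exists_eventually_contractsBy (E : Finset (∀ i, A i))
    (q : (∀ i, A i → ℝ) × (∀ i, A i → ℝ)) (hq : (DiagIFS.mk q.1 q.2 E).Valid) :
    ∃ m > 0, (DiagIFS.mk q.1 q.2 E).ContractsBy m ∧ ∀ η > 0, η ≤ 1 → ∀ᶠ q' in 𝓝 q,
      (DiagIFS.mk q'.1 q'.2 E).ContractsBy m ∧
        ∀ i a, |Real.log |q'.1 i a| - Real.log (|q.1 i a|)| ≤ η * m := by
  obtain ⟨-, h0, h1, -⟩ := hq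
  obtain ⟨m, hm, hqm⟩ : ∃ m > 0, ∀ x : Σ i, A i, 2 * m ≤ -Real.log |q.1 x.1 x.2| := by
    have hpos : ∀ x : Σ i, A i, 0 < -Real.log |q.1 x.1 x.2| := fun x =>
      neg_pos.2 (Real.log_neg (abs_pos.2 (h0 x.1 x.2)) (h1 x.1 x.2))
    rcases isEmpty_or_nonempty (Σ i, A i) with hemp | hne
    · exact ⟨1, one_pos, fun x => hemp.elim x⟩
    · obtain ⟨x, hx⟩ := Finite.exists_min fun x : Σ i, A i => -Real.log |q.1 x.1 x.2|
      exact ⟨_, half_pos (hpos x), fun y => by linarith [hx y]⟩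
  refine ⟨m, hm, fun i a => by linarith [hqm ⟨i, a⟩], fun η hη hη1 => ?_⟩
  have hev : ∀ᶠ q' in 𝓝 q, ∀ i a, |Real.log |q'.1 i a| - Real.log (|q.1 i a|)| < η * m := by
    refine eventually_all.2 fun i => eventually_all.2 fun a => ?_
    have hcont : ContinuousAt
        (fun q' : (∀ i, A i → ℝ) × (∀ i, A i → ℝ) => Real.log |q'.1 i a|) q :=
      ContinuousAt.log (by fun_prop) (abs_pos.2 (h0 i a)).ne'
    exact Metric.continuousAt_iff'.1 hcont (η * m) (by positivity)
  filter_upwards [hev] with q' hq'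
  refine ⟨fun i a => ?_, fun i a => (hq' i a).le⟩
  have h2 := abs_lt.1 (hq' i a)
  have h3 := hqm ⟨i, a⟩
  have h4 : η * m ≤ m := mul_le_of_le_one_left hm.le hη1
  simp only at h3 ⊢
  linarith [h2.2]

/-- A function whose oscillation is controlled by that of the logarithmic contraction rates is
continuous on the set of valid diagonal IFSes. -/
theorem continuousOn_valid_of_abs_sub_le {F : (∀ i, A i → ℝ) × (∀ i, A i → ℝ) → ℝ} {K : ℝ → ℝ}
    (hF : ∀ m > 0, ∀ η, 0 ≤ η → η ≤ 1 → ∀ q q', E.Nonempty →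
      (DiagIFS.mk q.1 q.2 E).ContractsBy m → (DiagIFS.mk q'.1 q'.2 E).ContractsBy m →
      (∀ i a, |Real.log |q.1 i a| - Real.log (|q'.1 i a|)| ≤ η * m) →
      |F q - F q'| ≤ K m * η) :
    ContinuousOn F {q | (DiagIFS.mk q.1 q.2 E).Valid} := by
  intro q hq
  refine ContinuousAt.continuousWithinAt (Metric.continuousAt_iff'.2 fun ε hε => ?_)
  obtain ⟨m, hm, hqm, hev⟩ := exists_eventually_contractsBy E q hq
  have hK : 0 < |K m| + 1 := by positivity
  have hη : 0 < min 1 (ε / (|K m| + 1)) := lt_min one_pos (by positivity)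
  filter_upwards [hev _ hη (min_le_left _ _)] with q' hq'
  rw [Real.dist_eq]
  refine (hF m hm _ hη.le (min_le_left _ _) q' q hq.1 hq'.1 hqm hq'.2).trans_lt ?_
  calc K m * min 1 (ε / (|K m| + 1)) < (|K m| + 1) * min 1 (ε / (|K m| + 1)) :=
        mul_lt_mul_of_pos_right (by linarith [le_abs_self (K m)]) hη
    _ ≤ (|K m| + 1) * (ε / (|K m| + 1)) :=
        mul_le_mul_of_nonneg_left (min_le_right _ _) hK.le
    _ = ε := by field_simp

end Comparison

/-- On the space of all diagonal IFSes with a fixed alphabet (parameterized by the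
slopes and translations of the defining similarities), the functions
`Φ ↦ sup_{r∈R} δ(r)` and `Φ ↦ sup_{p∈P} δ(p)` are continuous. -/
theorem sup_delta_continuousOn {d : ℕ} {A : Fin d → Type} [∀ i, Fintype (A i)]
    (E : Finset (∀ i, A i)) :
    ContinuousOn
      (fun q : (∀ i, A i → ℝ) × (∀ i, A i → ℝ) =>
        sSup {x : ℝ | ∃ c : Cycle (DiagIFS.mk q.1 q.2 E), x = c.delta})
      {q | (DiagIFS.mk q.1 q.2 E).Valid} ∧
    ContinuousOn
      (fun q : (∀ i, A i → ℝ) × (∀ i, A i → ℝ) =>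
        sSup {x : ℝ | ∃ p : (DiagIFS.mk q.1 q.2 E).Symb → ℝ, IsProbVec p ∧
          x = deltaP (DiagIFS.mk q.1 q.2 E) p})
      {q | (DiagIFS.mk q.1 q.2 E).Valid} := by
  exact ⟨continuousOn_valid_of_abs_sub_le (K := fun m => 2 * E.card * (d / m))
      fun _ hm _ hη hη1 _ _ hE hs hs' hss => abs_sSup_delta_sub_le hE hm hη hη1 hs hs' hss,
    continuousOn_valid_of_abs_sub_le (K := fun m => 2 * E.card * (d / m))
      fun _ hm _ hη _ _ _ hE hs hs' hss => abs_sSup_deltaP_sub_le hE hm hη hs hs' hss⟩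

end SelfAffineSponge
end
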